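/- arXiv:2209.00283 — 2 statements merged into one kernel-verified Lean document; each statement's English description precedes it below -/
import Mathlib

section
/- The conditional entropy of X|Y with respect to the set system 𝒥 admits the following two expressions: min over q ∈ K_q of [ ∑_x p_x ∑_{j∋x} q_{j|x} log q_{j|x} − ∑_y p^y ∑_{j∈𝒥} R_{j|y}(q) log R_{j|y}(q) ] equals min over r ∈ K_r of [ −∑_x p_x log( ∑_{j∋x} ∏_y (r_{j|y})^{p^{y|x}} ) ], and both minima are attained. -/
noncomputable section

open Finset

variable {X Y J : Type*}

/-- `f(u,v) = u·log u − u·log v` with the conventions `f(0,v) = 0` and `f(u,0) = +∞` for `u > 0`,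
taking values in the extended reals. -/
def fdiv (u v : ℝ) : EReal :=
  if u = 0 then 0
  else if v = 0 then (⊤ : EReal)
  else ((u * Real.log u - u * Real.log v : ℝ) : EReal)

/-- Marginal `p_x := ∑_y p_{x,y}`. -/
def margX [Fintype Y] (p : X → Y → ℝ) (x : X) : ℝ := ∑ y, p x y

/-- Marginal `p^y := ∑_x p_{x,y}`. -/
def margY [Fintype X] (p : X → Y → ℝ) (y : Y) : ℝ := ∑ x, p x y

/-- The polytope `K_q`: `q_{j|x} ≥ 0`, `∑_{j∋x} q_{j|x} = 1` for every `x`,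
and `q_{j|x} = 0` whenever `x ∉ j`. -/
def Kq [Fintype J] [DecidableEq X] (S : J → Finset X) : Set (J → X → ℝ) :=
  {q | (∀ j x, 0 ≤ q j x) ∧ (∀ x, (∑ j, if x ∈ S j then q j x else 0) = 1) ∧
    (∀ j x, x ∉ S j → q j x = 0)}

/-- The polytope `K_r`: `r_{j|y} ≥ 0` and `∑_j r_{j|y} = 1` for every `y`. -/
def Kr (J Y : Type*) [Fintype J] : Set (J → Y → ℝ) :=
  {r | (∀ j y, 0 ≤ r j y) ∧ ∀ y, (∑ j, r j y) = 1}

/-- `φ(q,r) := ∑_{x,y,j} p_{x,y} · f(q_{j|x}, r_{j|y})`, extended-real valued. -/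
def phi [Fintype X] [Fintype Y] [Fintype J] (p : X → Y → ℝ)
    (q : J → X → ℝ) (r : J → Y → ℝ) : EReal :=
  ∑ x, ∑ y, ∑ j, (p x y : EReal) * fdiv (q j x) (r j y)

/-- `δ(q,q') := ∑_x p_x ∑_{j∋x} f(q_{j|x}, q'_{j|x})`, extended-real valued. -/
def delta [Fintype X] [Fintype Y] [Fintype J] [DecidableEq X] (p : X → Y → ℝ)
    (S : J → Finset X) (q q' : J → X → ℝ) : EReal :=
  ∑ x, (margX p x : EReal) * ∑ j, (if x ∈ S j then fdiv (q j x) (q' j x) else 0)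

/-- `R_{j|y}(q) := ∑_{x∈j} p_{x|y} q_{j|x}`. -/
def Rmap [Fintype X] [Fintype Y] [DecidableEq X] (p : X → Y → ℝ) (S : J → Finset X)
    (q : J → X → ℝ) : J → Y → ℝ :=
  fun j y => ∑ x, if x ∈ S j then (p x y / margY p y) * q j x else 0

/-- `A_x(r) := ∑_{j∋x} ∏_y (r_{j|y})^{p^{y|x}}` (real powers, with `0^0 = 1`). -/
def Afun [Fintype Y] [Fintype J] [DecidableEq X] (p : X → Y → ℝ) (S : J → Finset X)
    (r : J → Y → ℝ) (x : X) : ℝ :=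
  ∑ j, if x ∈ S j then (∏ y, r j y ^ (p x y / margX p x)) else 0

/-- `Q_{j|x}(r) := (∏_y (r_{j|y})^{p^{y|x}}) / A_x(r)` if `x ∈ j`, and `0` otherwise. -/
def Qmap [Fintype Y] [Fintype J] [DecidableEq X] (p : X → Y → ℝ) (S : J → Finset X)
    (r : J → Y → ℝ) : J → X → ℝ :=
  fun j x => if x ∈ S j then (∏ y, r j y ^ (p x y / margX p x)) / Afun p S r x else 0

open Classical in
/-- `φ_r(r) := −∑_x p_x log A_x(r)`, equal to `+∞` if `A_x(r) = 0` for some `x`. -/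
def phiR [Fintype X] [Fintype Y] [Fintype J] [DecidableEq X] (p : X → Y → ℝ)
    (S : J → Finset X) (r : J → Y → ℝ) : EReal :=
  if ∃ x, Afun p S r x = 0 then ⊤
  else (((- ∑ x, margX p x * Real.log (Afun p S r x)) : ℝ) : EReal)

/-- The explicit real-valued formula for `φ_q`:
`∑_x p_x ∑_{j∋x} q_{j|x} log q_{j|x} − ∑_y p^y ∑_j R_{j|y}(q) log R_{j|y}(q)`
(with the convention `0·log 0 = 0`, automatic since `Real.log 0 = 0`). -/
def phiQexp [Fintype X] [Fintype Y] [Fintype J] [DecidableEq X] (p : X → Y → ℝ)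
    (S : J → Finset X) (q : J → X → ℝ) : ℝ :=
  (∑ x, margX p x * ∑ j, if x ∈ S j then q j x * Real.log (q j x) else 0)
    - ∑ y, margY p y * ∑ j, Rmap p S q j y * Real.log (Rmap p S q j y)

/-- The convex corner `K_a := {a : 0 ≤ a_x ≤ A_x(r) (∀x) for some r ∈ K_r}`. -/
def Ka [Fintype X] [Fintype Y] [Fintype J] [DecidableEq X] (p : X → Y → ℝ)
    (S : J → Finset X) : Set (X → ℝ) :=
  {a | ∃ r ∈ Kr J Y, ∀ x, 0 ≤ a x ∧ a x ≤ Afun p S r x}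

open Classical in
/-- `φ_a(a) := −∑_x p_x log a_x`, equal to `+∞` if `a_x = 0` for some `x`. -/
def phiA [Fintype X] [Fintype Y] (p : X → Y → ℝ) (a : X → ℝ) : EReal :=
  if ∃ x, a x = 0 then ⊤
  else (((- ∑ x, margX p x * Real.log (a x)) : ℝ) : EReal)

/-- Gibbs' inequality, for a probability vector `q` and an unnormalised nonnegative vector `a`. -/
theorem gibbs_inequality [Fintype J] (q a : J → ℝ) (hq : ∀ j, 0 ≤ q j) (hq1 : ∑ j, q j = 1)
    (ha : ∀ j, 0 ≤ a j) (hqa : ∀ j, 0 < q j → 0 < a j) :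
    0 < ∑ j, a j ∧
      ∑ j, q j * Real.log (a j) - ∑ j, q j * Real.log (q j) ≤ Real.log (∑ j, a j) := by
  obtain ⟨j₀, hj₀⟩ : ∃ j, 0 < q j := by
    by_contra! h
    have : ∑ j, q j ≤ 0 := Finset.sum_nonpos fun j _ => h j
    linarith
  have hA : 0 < ∑ j, a j :=
    Finset.sum_pos' (fun j _ => ha j) ⟨j₀, Finset.mem_univ _, hqa j₀ hj₀⟩
  refine ⟨hA, ?_⟩
  set A := ∑ j, a j with hAdef
  have key : ∀ j, q j * Real.log (a j) - q j * Real.log (q j) - q j * Real.log A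
      ≤ a j / A - q j := by
    intro j
    rcases (hq j).eq_or_lt with h | h
    · simpa [← h] using div_nonneg (ha j) hA.le
    · have haj := hqa j h
      have hlog := Real.log_le_sub_one_of_pos (div_pos haj (mul_pos h hA))
      rw [Real.log_div haj.ne' (mul_pos h hA).ne', Real.log_mul h.ne' hA.ne'] at hlog
      calc q j * Real.log (a j) - q j * Real.log (q j) - q j * Real.log A
          = q j * (Real.log (a j) - (Real.log (q j) + Real.log A)) := by ring
        _ ≤ q j * (a j / (q j * A) - 1) := mul_le_mul_of_nonneg_left hlog h.le
        _ = a j / A - q j := by field_simp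
  have hsum := Finset.sum_le_sum fun j (_ : j ∈ Finset.univ) => key j
  simp only [Finset.sum_sub_distrib, ← Finset.sum_mul, ← Finset.sum_div, hq1, ← hAdef,
    div_self hA.ne', one_mul] at hsum
  linarith

theorem Kq_sum_eq_one [Fintype J] [DecidableEq X] {S : J → Finset X} {q : J → X → ℝ}
    (hq : q ∈ Kq S) (x : X) : ∑ j, q j x = 1 := by
  rw [← hq.2.1 x]
  refine Finset.sum_congr rfl fun j _ => ?_
  split_ifs with h
  · rfl
  · exact hq.2.2 j x h

theorem Rmap_eq_sum [Fintype X] [Fintype Y] [Fintype J] [DecidableEq X] (p : X → Y → ℝ)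
    {S : J → Finset X} {q : J → X → ℝ} (hq : q ∈ Kq S) (j : J) (y : Y) :
    Rmap p S q j y = ∑ x, p x y / margY p y * q j x := by
  refine Finset.sum_congr rfl fun x _ => ?_
  split_ifs with h
  · rfl
  · rw [hq.2.2 j x h, mul_zero]

theorem phiQexp_eq [Fintype X] [Fintype Y] [Fintype J] [DecidableEq X] (p : X → Y → ℝ)
    {S : J → Finset X} {q : J → X → ℝ} (hq : q ∈ Kq S) :
    phiQexp p S q = (∑ x, margX p x * ∑ j, q j x * Real.log (q j x))
      - ∑ y, margY p y * ∑ j, Rmap p S q j y * Real.log (Rmap p S q j y) := by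
  unfold phiQexp
  congr 1
  refine Finset.sum_congr rfl fun x _ => ?_
  congr 1
  refine Finset.sum_congr rfl fun j _ => ?_
  split_ifs with h
  · rfl
  · rw [hq.2.2 j x h, zero_mul]

theorem Rmap_mem_Kr [Fintype X] [Fintype Y] [Fintype J] [DecidableEq X] {p : X → Y → ℝ}
    (hp : ∀ x y, 0 ≤ p x y) (hpy : ∀ y, 0 < margY p y) {S : J → Finset X} {q : J → X → ℝ}
    (hq : q ∈ Kq S) : Rmap p S q ∈ Kr J Y := by
  refine ⟨fun j y => ?_, fun y => ?_⟩
  · rw [Rmap_eq_sum p hq]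
    exact Finset.sum_nonneg fun x _ => mul_nonneg (div_nonneg (hp x y) (hpy y).le) (hq.1 j x)
  · simp only [Rmap_eq_sum p hq]
    rw [Finset.sum_comm]
    simp only [← Finset.mul_sum, Kq_sum_eq_one hq, mul_one]
    rw [← Finset.sum_div]
    exact div_self (hpy y).ne'

/-- Averaging `c` against `R(q)` over `y` is averaging its `p^{y|x}`-mean against `q` over `x`. -/
theorem sum_margY_mul_Rmap [Fintype X] [Fintype Y] [Fintype J] [DecidableEq X] {p : X → Y → ℝ}
    (hpx : ∀ x, 0 < margX p x) (hpy : ∀ y, 0 < margY p y) {S : J → Finset X} {q : J → X → ℝ}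
    (hq : q ∈ Kq S) (c : J → Y → ℝ) :
    ∑ y, margY p y * ∑ j, Rmap p S q j y * c j y
      = ∑ x, margX p x * ∑ j, q j x * ∑ y, p x y / margX p x * c j y := by
  have hL : ∀ y, margY p y * ∑ j, Rmap p S q j y * c j y
      = ∑ x, ∑ j, p x y * q j x * c j y := by
    intro y
    simp only [Rmap_eq_sum p hq, Finset.mul_sum, Finset.sum_mul]
    rw [Finset.sum_comm]
    refine Finset.sum_congr rfl fun x _ => Finset.sum_congr rfl fun j _ => ?_
    have := (hpy y).ne'
    field_simp
  have hR : ∀ x, margX p x * ∑ j, q j x * ∑ y, p x y / margX p x * c j y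
      = ∑ y, ∑ j, p x y * q j x * c j y := by
    intro x
    simp only [Finset.mul_sum]
    rw [Finset.sum_comm]
    refine Finset.sum_congr rfl fun y _ => Finset.sum_congr rfl fun j _ => ?_
    have := (hpx x).ne'
    field_simp
  simp only [hL, hR]
  exact Finset.sum_comm

theorem prod_rpow_pos_and_log {ι : Type*} [Fintype ι] {r w : ι → ℝ} (hr : ∀ i, 0 ≤ r i)
    (hrw : ∀ i, w i ≠ 0 → r i ≠ 0) :
    0 < ∏ i, r i ^ w i ∧ Real.log (∏ i, r i ^ w i) = ∑ i, w i * Real.log (r i) := by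
  have hpos : ∀ i, 0 < r i ^ w i := by
    intro i
    by_cases h : w i = 0
    · simp [h]
    · exact Real.rpow_pos_of_pos ((hr i).lt_of_ne' (hrw i h)) _
  refine ⟨Finset.prod_pos fun i _ => hpos i, ?_⟩
  rw [Real.log_prod fun i _ => (hpos i).ne']
  refine Finset.sum_congr rfl fun i _ => ?_
  by_cases h : w i = 0
  · simp [h]
  · exact Real.log_rpow ((hr i).lt_of_ne' (hrw i h)) _

theorem prod_rpow_nonneg {ι : Type*} [Fintype ι] {r : ι → ℝ} (w : ι → ℝ) (hr : ∀ i, 0 ≤ r i) :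
    0 ≤ ∏ i, r i ^ w i :=
  Finset.prod_nonneg fun i _ => Real.rpow_nonneg (hr i) _

theorem Rmap_ne_zero [Fintype X] [Fintype Y] [Fintype J] [DecidableEq X] {p : X → Y → ℝ}
    (hp : ∀ x y, 0 ≤ p x y) (hpy : ∀ y, 0 < margY p y) {S : J → Finset X} {q : J → X → ℝ}
    (hq : q ∈ Kq S) {j : J} {x : X} {y : Y} (hj : 0 < q j x) (hxy : p x y ≠ 0) :
    Rmap p S q j y ≠ 0 := by
  rw [Rmap_eq_sum p hq]
  refine (Finset.sum_pos'
    (fun x _ => mul_nonneg (div_nonneg (hp x y) (hpy y).le) (hq.1 j x))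
    ⟨x, Finset.mem_univ _, ?_⟩).ne'
  exact mul_pos (div_pos ((hp x y).lt_of_ne' hxy) (hpy y)) hj

theorem phiR_Rmap_le [Fintype X] [Fintype Y] [Fintype J] [DecidableEq X] {p : X → Y → ℝ}
    (hp : ∀ x y, 0 ≤ p x y) (hpx : ∀ x, 0 < margX p x) (hpy : ∀ y, 0 < margY p y)
    {S : J → Finset X} {q : J → X → ℝ} (hq : q ∈ Kq S) :
    phiR p S (Rmap p S q) ≤ phiQexp p S q := by
  have hr := Rmap_mem_Kr hp hpy hq
  set r := Rmap p S q with hrdef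
  have hprod : ∀ j x, 0 < q j x → 0 < ∏ y, r j y ^ (p x y / margX p x) ∧
      Real.log (∏ y, r j y ^ (p x y / margX p x))
        = ∑ y, p x y / margX p x * Real.log (r j y) := by
    intro j x hj
    refine prod_rpow_pos_and_log (hr.1 j) fun y hy => Rmap_ne_zero hp hpy hq hj ?_
    intro h
    simp [h] at hy
  have hmem : ∀ j x, 0 < q j x → x ∈ S j := by
    intro j x hj
    by_contra h
    exact hj.ne' (hq.2.2 j x h)
  have hg : ∀ x, 0 < Afun p S r x ∧
      (∑ j, q j x * ∑ y, p x y / margX p x * Real.log (r j y))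
        - ∑ j, q j x * Real.log (q j x) ≤ Real.log (Afun p S r x) := by
    intro x
    have h := gibbs_inequality (fun j => q j x)
      (fun j => if x ∈ S j then (∏ y, r j y ^ (p x y / margX p x)) else 0)
      (fun j => hq.1 j x) (Kq_sum_eq_one hq x)
      (fun j => by
        split_ifs
        · exact prod_rpow_nonneg _ (hr.1 j)
        · exact le_rfl)
      (fun j hj => by simpa [hmem j x hj] using (hprod j x hj).1)
    refine ⟨h.1, le_trans (le_of_eq ?_) h.2⟩
    congr 1
    refine Finset.sum_congr rfl fun j _ => ?_
    rcases (hq.1 j x).eq_or_lt with h0 | h0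
    · simp [← h0]
    · simp only [if_pos (hmem j x h0), (hprod j x h0).2]
  have hno : ¬ ∃ x, Afun p S r x = 0 := fun ⟨x, hx⟩ => (hg x).1.ne' hx
  rw [phiR, if_neg hno, EReal.coe_le_coe_iff, phiQexp_eq p hq, ← hrdef]
  have hswap := sum_margY_mul_Rmap hpx hpy hq fun j y => Real.log (r j y)
  rw [← hrdef] at hswap
  rw [hswap]
  have hsum := Finset.sum_le_sum fun x (_ : x ∈ Finset.univ) =>
    mul_le_mul_of_nonneg_left (hg x).2 (hpx x).le
  simp only [mul_sub, Finset.sum_sub_distrib] at hsum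
  linarith

theorem Afun_nonneg [Fintype Y] [Fintype J] [DecidableEq X] (p : X → Y → ℝ) (S : J → Finset X)
    {r : J → Y → ℝ} (hr : ∀ j y, 0 ≤ r j y) (x : X) : 0 ≤ Afun p S r x := by
  refine Finset.sum_nonneg fun j _ => ?_
  split_ifs
  · exact prod_rpow_nonneg _ (hr j)
  · exact le_rfl

theorem Qmap_mem_Kq [Fintype Y] [Fintype J] [DecidableEq X] (p : X → Y → ℝ) (S : J → Finset X)
    {r : J → Y → ℝ} (hr : ∀ j y, 0 ≤ r j y) (hA : ∀ x, Afun p S r x ≠ 0) :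
    Qmap p S r ∈ Kq S := by
  refine ⟨fun j x => ?_, fun x => ?_, fun j x h => by simp [Qmap, h]⟩
  · unfold Qmap
    split_ifs
    · exact div_nonneg (prod_rpow_nonneg _ (hr j)) (Afun_nonneg p S hr x)
    · exact le_rfl
  · have : ∀ j, (if x ∈ S j then Qmap p S r j x else 0)
        = (if x ∈ S j then (∏ y, r j y ^ (p x y / margX p x)) else 0) / Afun p S r x := by
      intro j
      by_cases h : x ∈ S j <;> simp [Qmap, h]
    simp only [this]
    rw [← Finset.sum_div]
    exact div_self (hA x)

theorem phiQexp_Qmap_le [Fintype X] [Fintype Y] [Fintype J] [DecidableEq X] {p : X → Y → ℝ}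
    (hp : ∀ x y, 0 ≤ p x y) (hpx : ∀ x, 0 < margX p x) (hpy : ∀ y, 0 < margY p y)
    {S : J → Finset X} {r : J → Y → ℝ} (hr : r ∈ Kr J Y) (hA : ∀ x, Afun p S r x ≠ 0) :
    phiQexp p S (Qmap p S r) ≤ - ∑ x, margX p x * Real.log (Afun p S r x) := by
  have hq := Qmap_mem_Kq p S hr.1 hA
  set q := Qmap p S r with hqdef
  have hR := Rmap_mem_Kr hp hpy hq
  have hrne : ∀ j x, q j x ≠ 0 → ∀ y, p x y / margX p x ≠ 0 → r j y ≠ 0 := by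
    intro j x hj y hy h0
    apply hj
    have : ∏ y, r j y ^ (p x y / margX p x) = 0 :=
      Finset.prod_eq_zero (Finset.mem_univ y) (by rw [h0, Real.zero_rpow hy])
    simp [hqdef, Qmap, this]
  have hlog : ∀ x, ∑ j, q j x * Real.log (q j x)
      = (∑ j, q j x * ∑ y, p x y / margX p x * Real.log (r j y))
        - Real.log (Afun p S r x) := by
    intro x
    have hterm : ∀ j, q j x * Real.log (q j x)
        = q j x * (∑ y, p x y / margX p x * Real.log (r j y))
          - q j x * Real.log (Afun p S r x) := by
      intro j
      by_cases h : q j x = 0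
      · simp [h]
      have hS : x ∈ S j := by
        by_contra hS
        exact h (hq.2.2 j x hS)
      obtain ⟨hpos, hlogprod⟩ := prod_rpow_pos_and_log (hr.1 j) (hrne j x h)
      have hqv : q j x = (∏ y, r j y ^ (p x y / margX p x)) / Afun p S r x := by
        simp [hqdef, Qmap, hS]
      rw [← mul_sub, ← hlogprod, ← Real.log_div hpos.ne' (hA x), ← hqv]
    simp only [hterm, Finset.sum_sub_distrib, ← Finset.sum_mul, Kq_sum_eq_one hq, one_mul]
  have hgibbs : ∀ y, ∑ j, Rmap p S q j y * Real.log (r j y)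
      ≤ ∑ j, Rmap p S q j y * Real.log (Rmap p S q j y) := by
    intro y
    have h := (gibbs_inequality (fun j => Rmap p S q j y) (fun j => r j y)
      (fun j => hR.1 j y) (hR.2 y) (fun j => hr.1 j y) (fun j hj => by
        refine (hr.1 j y).lt_of_ne' fun h0 => hj.ne' ?_
        rw [Rmap_eq_sum p hq]
        refine Finset.sum_eq_zero fun x _ => ?_
        by_cases hxy : p x y = 0
        · simp [hxy]
        · have : q j x = 0 := by
            by_contra hne
            exact hrne j x hne y (div_ne_zero hxy (hpx x).ne') h0
          simp [this])).2
    rw [hr.2 y, Real.log_one] at h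
    linarith
  rw [phiQexp_eq p hq]
  have hswap := sum_margY_mul_Rmap hpx hpy hq fun j y => Real.log (r j y)
  have hsum := Finset.sum_le_sum fun y (_ : y ∈ Finset.univ) =>
    mul_le_mul_of_nonneg_left (hgibbs y) (hpy y).le
  simp only [hlog, mul_sub, Finset.sum_sub_distrib]
  linarith

theorem isCompact_Kq [Fintype J] [DecidableEq X] (S : J → Finset X) : IsCompact (Kq S) := by
  have hsub : Kq S ⊆ Set.univ.pi fun _ : J => Set.univ.pi fun _ : X => Set.Icc (0 : ℝ) 1 := by
    intro q hq j _ x _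
    refine ⟨hq.1 j x, ?_⟩
    rw [← Kq_sum_eq_one hq x]
    exact Finset.single_le_sum (f := fun j => q j x) (fun j _ => hq.1 j x) (Finset.mem_univ j)
  refine (isCompact_univ_pi fun _ => isCompact_univ_pi fun _ => isCompact_Icc).of_isClosed_subset
    ?_ hsub
  have h₁ : IsClosed {q : J → X → ℝ | ∀ j x, 0 ≤ q j x} := by
    simp only [Set.ofPred_forall]
    exact isClosed_iInter fun j => isClosed_iInter fun x =>
      isClosed_le continuous_const (by fun_prop)
  have h₂ : IsClosed {q : J → X → ℝ | ∀ x, (∑ j, if x ∈ S j then q j x else 0) = 1} := by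
    simp only [Set.ofPred_forall]
    refine isClosed_iInter fun x => isClosed_eq (continuous_finsetSum _ fun j _ => ?_)
      continuous_const
    split_ifs <;> fun_prop
  have h₃ : IsClosed {q : J → X → ℝ | ∀ j x, x ∉ S j → q j x = 0} := by
    simp only [Set.ofPred_forall]
    exact isClosed_iInter fun j => isClosed_iInter fun x => isClosed_iInter fun _ =>
      isClosed_eq (by fun_prop) continuous_const
  exact h₁.inter (h₂.inter h₃)

theorem continuous_phiQexp [Fintype X] [Fintype Y] [Fintype J] [DecidableEq X] (p : X → Y → ℝ)
    (S : J → Finset X) : Continuous (phiQexp p S) := by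
  have hR : ∀ j y, Continuous fun q : J → X → ℝ => Rmap p S q j y := by
    intro j y
    refine continuous_finsetSum _ fun x _ => ?_
    split_ifs <;> fun_prop
  refine Continuous.sub ?_ ?_
  · refine continuous_finsetSum _ fun x _ => continuous_const.mul
      (continuous_finsetSum _ fun j _ => ?_)
    split_ifs
    · exact Real.continuous_mul_log.comp (by fun_prop : Continuous fun q : J → X → ℝ => q j x)
    · exact continuous_const
  · exact continuous_finsetSum _ fun y _ => continuous_const.mul
      (continuous_finsetSum _ fun j _ => Real.continuous_mul_log.comp (hR j y))

theorem Kq_nonempty [Fintype J] [DecidableEq X] {S : J → Finset X}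
    (hcov : ∀ x, ∃ j, x ∈ S j) : (Kq S).Nonempty := by
  classical
  choose f hf using hcov
  refine ⟨fun j x => if j = f x then 1 else 0, fun j x => ?_, fun x => ?_, fun j x h => ?_⟩
  · dsimp only
    split_ifs <;> norm_num
  · rw [Finset.sum_eq_single (f x)] <;> simp +contextual [hf]
  · refine if_neg ?_
    rintro rfl
    exact h (hf x)

/-- the conditional entropy `H_𝒥(X|Y)` admits the two expressions
`min_{q ∈ K_q} [∑_x p_x ∑_{j∋x} q_{j|x} log q_{j|x} − ∑_y p^y ∑_j R_{j|y}(q) log R_{j|y}(q)]`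
`= min_{r ∈ K_r} [−∑_x p_x log(∑_{j∋x} ∏_y (r_{j|y})^{p^{y|x}})]`, both minima attained. -/
theorem two_expressions_for_conditional_entropy (X Y J : Type*) [Fintype X] [Fintype Y]
    [Fintype J] [Nonempty X] [Nonempty Y] [DecidableEq X]
    (p : X → Y → ℝ) (S : J → Finset X)
    (hp : ∀ x y, 0 ≤ p x y) (hptot : ∑ x, ∑ y, p x y = 1)
    (hpx : ∀ x, 0 < margX p x) (hpy : ∀ y, 0 < margY p y)
    (hcov : ∀ x, ∃ j, x ∈ S j) :
    ∃ q0 ∈ Kq S, ∃ r0 ∈ Kr J Y,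
      (∀ q ∈ Kq S, phiQexp p S q0 ≤ phiQexp p S q) ∧
      (∀ r ∈ Kr J Y, phiR p S r0 ≤ phiR p S r) ∧
      ((phiQexp p S q0 : EReal) = phiR p S r0) := by
  obtain ⟨q0, hq0, hmin⟩ :=
    (isCompact_Kq S).exists_isMinOn (Kq_nonempty hcov) (continuous_phiQexp p S).continuousOn
  have hle : ∀ r ∈ Kr J Y, (phiQexp p S q0 : EReal) ≤ phiR p S r := by
    intro r hr
    unfold phiR
    split_ifs with h
    · exact le_top
    · push Not at h
      exact EReal.coe_le_coe_iff.2
        ((hmin (Qmap_mem_Kq p S hr.1 h)).trans (phiQexp_Qmap_le hp hpx hpy hr h))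
  have hr0 := Rmap_mem_Kr hp hpy hq0
  have hback := phiR_Rmap_le hp hpx hpy hq0
  exact ⟨q0, hq0, Rmap p S q0, hr0, fun q hq => hmin hq, fun r hr => hback.trans (hle r hr),
    (hle _ hr0).antisymm hback⟩
end
end

section
/- If r ∈ K_r satisfies A_x(r) = 0 for some x ∈ 𝒳, then φ(q, r) = +∞ for every q ∈ K_q. -/
noncomputable section

open Finset

variable {X Y J : Type*}

lemma fdiv_ne_bot (u v : ℝ) : fdiv u v ≠ ⊥ := by
  unfold fdiv
  split_ifs
  · exact EReal.zero_ne_bot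
  · exact top_ne_bot
  · exact EReal.coe_ne_bot _

lemma coe_mul_fdiv_ne_bot {c : ℝ} (hc : 0 ≤ c) (u v : ℝ) : (c : EReal) * fdiv u v ≠ ⊥ := by
  rw [Ne, EReal.mul_eq_bot]
  simp [fdiv_ne_bot, hc.not_gt]

lemma EReal.finset_sum_ne_bot {ι : Type*} {s : Finset ι} {f : ι → EReal}
    (hf : ∀ i ∈ s, f i ≠ ⊥) : ∑ i ∈ s, f i ≠ ⊥ :=
  Finset.sum_induction f (· ≠ ⊥) (fun _ _ ha hb ↦ EReal.add_ne_bot_iff.2 ⟨ha, hb⟩)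
    EReal.zero_ne_bot hf

lemma EReal.finset_sum_eq_top {ι : Type*} {s : Finset ι} {f : ι → EReal}
    (hf : ∀ i ∈ s, f i ≠ ⊥) {i : ι} (hi : i ∈ s) (htop : f i = ⊤) : ∑ i ∈ s, f i = ⊤ := by
  classical
  rw [← Finset.add_sum_erase s f hi, htop]
  exact EReal.top_add_of_ne_bot
    (EReal.finset_sum_ne_bot fun k hk ↦ hf k (Finset.mem_of_mem_erase hk))

lemma phi_eq_top_of_zero [Fintype X] [Fintype Y] [Fintype J] {p : X → Y → ℝ}
    (hp : ∀ x y, 0 ≤ p x y) {q : J → X → ℝ} {r : J → Y → ℝ} {x : X} {y : Y} {j : J}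
    (hpxy : p x y ≠ 0) (hq : q j x ≠ 0) (hr : r j y = 0) : phi p q r = ⊤ := by
  have hJ (a : X) (b : Y) (k : J) : (p a b : EReal) * fdiv (q k a) (r k b) ≠ ⊥ :=
    coe_mul_fdiv_ne_bot (hp a b) _ _
  have hY (a : X) (b : Y) := EReal.finset_sum_ne_bot (s := univ) fun k _ ↦ hJ a b k
  have hX (a : X) := EReal.finset_sum_ne_bot (s := univ) fun b _ ↦ hY a b
  refine EReal.finset_sum_eq_top (fun a _ ↦ hX a) (mem_univ x) ?_
  refine EReal.finset_sum_eq_top (fun b _ ↦ hY x b) (mem_univ y) ?_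
  refine EReal.finset_sum_eq_top (fun k _ ↦ hJ x y k) (mem_univ j) ?_
  have hpos : 0 < p x y := (hp x y).lt_of_ne' hpxy
  simp [fdiv, hq, hr, EReal.coe_mul_top_of_pos hpos]

lemma exists_eq_zero_of_Afun_eq_zero [Fintype Y] [Fintype J] [DecidableEq X]
    {p : X → Y → ℝ} {S : J → Finset X} {r : J → Y → ℝ} (hr : ∀ j y, 0 ≤ r j y) {x : X}
    (hA : Afun p S r x = 0) {j : J} (hj : x ∈ S j) : ∃ y, p x y ≠ 0 ∧ r j y = 0 := by
  have hterm (k : J) (_ : k ∈ univ) :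
      0 ≤ if x ∈ S k then ∏ y, r k y ^ (p x y / margX p x) else 0 := by
    split_ifs
    · exact prod_nonneg fun y _ ↦ Real.rpow_nonneg (hr k y) _
    · exact le_rfl
  have hprod := (sum_eq_zero_iff_of_nonneg hterm).1 hA j (mem_univ j)
  rw [if_pos hj, prod_eq_zero_iff] at hprod
  obtain ⟨y, -, hy⟩ := hprod
  obtain ⟨hry, hexp⟩ := (Real.rpow_eq_zero_iff_of_nonneg (hr j y)).1 hy
  exact ⟨y, fun h ↦ hexp (by rw [h, zero_div]), hry⟩

/-- if `r ∈ K_r` satisfies `A_x(r) = 0` for some `x`, then `φ(q,r) = +∞`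
for every `q ∈ K_q`. -/
theorem phi_eq_top_of_Afun_eq_zero (X Y J : Type*) [Fintype X] [Fintype Y] [Fintype J]
    [Nonempty X] [Nonempty Y] [DecidableEq X]
    (p : X → Y → ℝ) (S : J → Finset X)
    (hp : ∀ x y, 0 ≤ p x y) (hptot : ∑ x, ∑ y, p x y = 1)
    (hpx : ∀ x, 0 < margX p x) (hpy : ∀ y, 0 < margY p y)
    (hcov : ∀ x, ∃ j, x ∈ S j) :
    ∀ r ∈ Kr J Y, (∃ x, Afun p S r x = 0) → ∀ q ∈ Kq S, phi p q r = ⊤ := by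
  rintro r ⟨hr, -⟩ ⟨x, hA⟩ q ⟨-, hqsum, -⟩
  obtain ⟨j, -, hj⟩ := exists_ne_zero_of_sum_ne_zero
    (show (∑ j, if x ∈ S j then q j x else 0) ≠ 0 by rw [hqsum x]; exact one_ne_zero)
  obtain ⟨hjx, hq⟩ := ite_ne_right_iff.1 hj
  obtain ⟨y, hpxy, hry⟩ := exists_eq_zero_of_Afun_eq_zero hr hA hjx
  exact phi_eq_top_of_zero hp hpxy hq hry
end
end
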